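/- arXiv:1312.4112 — 3 statements merged into one kernel-verified Lean document; each statement's English description precedes it below -/
import Mathlib

section
/- Let a, b, α be positive integers and let p be a prime number; if p = 2, assume furthermore that α ≥ 2. Then binom(p^α·a − 1, p^α·b − 1) ≡ binom(p^{α−1}·a − 1, p^{α−1}·b − 1) (mod p^{2α}). -/
theorem choose_prod_aux (N : ℕ) (hN : 1 ≤ N) (M : ℕ) (hM : 1 ≤ M) :
    (((N - 1).choose (M - 1) : ℕ) : ℤ) * ∏ k ∈ Finset.Ico 1 M, (k : ℤ) =
      ∏ k ∈ Finset.Ico 1 M, ((N : ℤ) - k) := by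
  induction M, hM using Nat.le_induction with
  | base => simp
  | succ M hM ih =>
    rw [Finset.prod_Ico_succ_top hM, Finset.prod_Ico_succ_top hM, ← ih]
    have h := Nat.choose_succ_right_eq (N - 1) (M - 1)
    rw [Nat.sub_add_cancel hM] at h
    have h' : (((N - 1).choose M : ℕ) : ℤ) * M =
        (((N - 1).choose (M - 1) : ℕ) : ℤ) * ((N : ℤ) - M) := by
      by_cases hle : M ≤ N
      · have e : ((N - 1 - (M - 1) : ℕ) : ℤ) = (N : ℤ) - M := by omega
        rw [← e]
        exact_mod_cast h
      · rw [Nat.choose_eq_zero_of_lt (by omega : N - 1 < M),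
          Nat.choose_eq_zero_of_lt (by omega : N - 1 < M - 1)]
        simp
    simp only [Nat.add_sub_cancel]
    linear_combination (∏ k ∈ Finset.Ico 1 M, (k : ℤ)) * h'

theorem filter_dvd_aux (p : ℕ) (hp : 0 < p) (B : ℕ) (f : ℕ → ℤ) :
    ∏ k ∈ (Finset.Ico 1 (p * B)).filter (fun k => p ∣ k), f k =
      ∏ j ∈ Finset.Ico 1 B, f (p * j) := by
  symm
  apply Finset.prod_bij (fun j _ => p * j)
  · intro j hj
    simp only [Finset.mem_filter, Finset.mem_Ico] at hj ⊢
    exact ⟨⟨Nat.mul_pos hp hj.1, Nat.mul_lt_mul_of_pos_left hj.2 hp⟩, dvd_mul_right _ _⟩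
  · intro i _ j _ h
    exact Nat.eq_of_mul_eq_mul_left hp h
  · intro k hk
    simp only [Finset.mem_filter, Finset.mem_Ico] at hk
    obtain ⟨⟨h1, h2⟩, j, rfl⟩ := hk
    exact ⟨j, Finset.mem_Ico.2 ⟨Nat.pos_of_mul_pos_left h1, Nat.lt_of_mul_lt_mul_left h2⟩, rfl⟩
  · intro j _
    rfl

theorem unit_prod_aux (a b n p : ℕ) (hp : p.Prime) (s : ℕ) (hs : n ^ 2 = p ^ s) (hpn : p ∣ n)
    (h4 : p = 2 → 4 ∣ n) :
    ∏ k ∈ (Finset.Ico 1 (n * b)).filter (fun k => ¬ p ∣ k),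
      ((((n * a : ℕ) : ZMod (n ^ 2)) - (k : ZMod (n ^ 2))) * (k : ZMod (n ^ 2))⁻¹) = 1 := by
  have hinv : ∀ k : ℕ, ¬ p ∣ k → (k : ZMod (n ^ 2)) * (k : ZMod (n ^ 2))⁻¹ = 1 := by
    intro k hk
    apply ZMod.coe_mul_inv_eq_one
    rw [hs]
    exact (Nat.Coprime.pow_left s ((hp.coprime_iff_not_dvd).2 hk)).symm
  have hn : (n : ZMod (n ^ 2)) ^ 2 = 0 := by
    have := ZMod.natCast_self (n ^ 2)
    exact_mod_cast this
  have hnd : ∀ k, k < n * b → ¬ p ∣ k → ¬ p ∣ n * b - k := by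
    intro k hk h h'
    apply h
    have := Nat.dvd_sub (hpn.mul_right b) h'
    rwa [Nat.sub_sub_self hk.le] at this
  apply Finset.prod_involution (fun k _ => n * b - k)
  · intro k hk
    simp only [Finset.mem_filter, Finset.mem_Ico] at hk
    obtain ⟨⟨h1, hlt⟩, hd⟩ := hk
    have e1 := hinv k hd
    have e2 := hinv _ (hnd k hlt hd)
    rw [Nat.cast_sub hlt.le] at e2 ⊢
    push_cast at e2 ⊢
    generalize ((n : ZMod (n ^ 2)) * b - k)⁻¹ = v at *
    generalize (k : ZMod (n ^ 2))⁻¹ = u at *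
    generalize (k : ZMod (n ^ 2)) = x at *
    generalize (n : ZMod (n ^ 2)) = y at *
    linear_combination (u * v * (a ^ 2 - a * b)) * hn + e1 * (y * b - x) * v + e2
  · intro k hk _ heq
    simp only [Finset.mem_filter, Finset.mem_Ico] at hk
    obtain ⟨⟨h1, hlt⟩, hd⟩ := hk
    have h2k : n * b = 2 * k := by omega
    by_cases h2 : p = 2
    · obtain ⟨c, hc⟩ := h4 h2
      subst h2
      apply hd
      refine ⟨c * b, ?_⟩
      rw [hc] at h2k
      nlinarith
    · have : p ∣ 2 * k := h2k ▸ hpn.mul_right b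
      rcases (hp.dvd_mul).1 this with h | h
      · exact h2 ((Nat.prime_dvd_prime_iff_eq hp Nat.prime_two).1 h)
      · exact hd h
  · intro k hk
    simp only [Finset.mem_filter, Finset.mem_Ico] at hk ⊢
    exact ⟨by omega, hnd k hk.1.2 hk.2⟩
  · intro k hk
    simp only [Finset.mem_filter, Finset.mem_Ico] at hk
    omega

/-- Peng. For positive integers `a, b, α` and a prime `p`
(with `α ≥ 2` if `p = 2`),
`binom(p^α a − 1, p^α b − 1) ≡ binom(p^{α−1} a − 1, p^{α−1} b − 1) (mod p^{2α})`. -/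
theorem peng_binomial_congruence (a b α : ℕ) (ha : 1 ≤ a) (hb : 1 ≤ b) (hα : 1 ≤ α)
    (p : ℕ) (hp : p.Prime) (h2 : p = 2 → 2 ≤ α) :
    ((p ^ α * a - 1).choose (p ^ α * b - 1) : ℤ) ≡
      ((p ^ (α - 1) * a - 1).choose (p ^ (α - 1) * b - 1) : ℤ) [ZMOD (p : ℤ) ^ (2 * α)] := by
  have hm : 0 < p ^ (α - 1) := pow_pos hp.pos _
  have hn : 0 < p ^ α := pow_pos hp.pos _
  have hnm : p ^ α = p * p ^ (α - 1) := by
    rw [← pow_succ', Nat.sub_add_cancel hα]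
  have hs : (p ^ α) ^ 2 = p ^ (2 * α) := by rw [← pow_mul, mul_comm]
  have hpn : p ∣ p ^ α := dvd_pow_self p (by omega)
  have h4 : p = 2 → 4 ∣ p ^ α := by
    intro h
    have := pow_dvd_pow p (h2 h)
    subst h
    exact this
  have hU := unit_prod_aux a b (p ^ α) p hp (2 * α) hs hpn h4
  have A := choose_prod_aux (p ^ α * a) (Nat.mul_pos hn ha) (p ^ α * b) (Nat.mul_pos hn hb)
  have B := choose_prod_aux (p ^ (α - 1) * a) (Nat.mul_pos hm ha) (p ^ (α - 1) * b)
    (Nat.mul_pos hm hb)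
  rw [← Finset.prod_filter_mul_prod_filter_not (Finset.Ico 1 (p ^ α * b)) (fun k => p ∣ k),
    ← Finset.prod_filter_mul_prod_filter_not (Finset.Ico 1 (p ^ α * b)) (fun k => p ∣ k)] at A
  have hnb : p ^ α * b = p * (p ^ (α - 1) * b) := by rw [hnm, mul_assoc]
  have D1 := filter_dvd_aux p hp.pos (p ^ (α - 1) * b) (fun k => (k : ℤ))
  have D2 := filter_dvd_aux p hp.pos (p ^ (α - 1) * b) (fun k => ((p ^ α * a : ℕ) : ℤ) - k)
  have D3 : ∏ j ∈ Finset.Ico 1 (p ^ (α - 1) * b), (((p ^ α * a : ℕ) : ℤ) - ((p * j : ℕ) : ℤ)) =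
      (((p ^ (α - 1) * a - 1).choose (p ^ (α - 1) * b - 1) : ℕ) : ℤ) *
      ∏ j ∈ Finset.Ico 1 (p ^ (α - 1) * b), ((p * j : ℕ) : ℤ) := by
    have e1 : ∀ j : ℕ, ((p ^ α * a : ℕ) : ℤ) - ((p * j : ℕ) : ℤ) =
        (p : ℤ) * (((p ^ (α - 1) * a : ℕ) : ℤ) - j) := by
      intro j; rw [hnm]; push_cast; ring
    simp only [e1]
    simp only [Nat.cast_mul p]
    rw [Finset.prod_mul_distrib, Finset.prod_mul_distrib, ← B]
    ring
  have D0 : ∏ j ∈ Finset.Ico 1 (p ^ (α - 1) * b), ((p * j : ℕ) : ℤ) ≠ 0 := by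
    rw [Finset.prod_ne_zero_iff]
    intro j hj
    have := (Finset.mem_Ico.1 hj).1
    exact_mod_cast (Nat.mul_pos hp.pos this).ne'
  rw [← hnb] at D1 D2
  rw [D1, D2, D3] at A
  rw [mul_left_comm, mul_comm (((p ^ (α - 1) * a - 1).choose (p ^ (α - 1) * b - 1) : ℕ) : ℤ),
    mul_assoc] at A
  have A' := mul_left_cancel₀ D0 A
  have key := congrArg (Int.cast : ℤ → ZMod ((p ^ α) ^ 2)) A'
  have hinv : ∀ k : ℕ, ¬ p ∣ k → (k : ZMod ((p ^ α) ^ 2)) * (k : ZMod ((p ^ α) ^ 2))⁻¹ = 1 := by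
    intro k hk
    apply ZMod.coe_mul_inv_eq_one
    rw [hs]
    exact (Nat.Coprime.pow_left _ ((hp.coprime_iff_not_dvd).2 hk)).symm
  have hV : (∏ k ∈ (Finset.Ico 1 (p ^ α * b)).filter (fun k => ¬ p ∣ k),
      (k : ZMod ((p ^ α) ^ 2))) *
      (∏ k ∈ (Finset.Ico 1 (p ^ α * b)).filter (fun k => ¬ p ∣ k),
      (k : ZMod ((p ^ α) ^ 2))⁻¹) = 1 := by
    rw [← Finset.prod_mul_distrib]
    apply Finset.prod_eq_one
    intro k hk
    exact hinv k (Finset.mem_filter.1 hk).2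
  rw [Finset.prod_mul_distrib] at hU
  have hmod : (p : ℤ) ^ (2 * α) = (((p ^ α) ^ 2 : ℕ) : ℤ) := by
    rw [hs]; push_cast; rfl
  rw [hmod, ← ZMod.intCast_eq_intCast_iff]
  simp only [Int.cast_mul, Int.cast_prod, Int.cast_sub, Int.cast_natCast] at key ⊢
  generalize (∏ k ∈ (Finset.Ico 1 (p ^ α * b)).filter (fun k => ¬ p ∣ k),
      (k : ZMod ((p ^ α) ^ 2))⁻¹) = V at *
  generalize (∏ k ∈ (Finset.Ico 1 (p ^ α * b)).filter (fun k => ¬ p ∣ k),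
      (k : ZMod ((p ^ α) ^ 2))) = P at *
  generalize (∏ k ∈ (Finset.Ico 1 (p ^ α * b)).filter (fun k => ¬ p ∣ k),
      (((p ^ α * a : ℕ) : ZMod ((p ^ α) ^ 2)) - (k : ZMod ((p ^ α) ^ 2)))) = Q at *
  generalize (((p ^ α * a - 1).choose (p ^ α * b - 1) : ℕ) : ZMod ((p ^ α) ^ 2)) = X at *
  generalize (((p ^ (α - 1) * a - 1).choose (p ^ (α - 1) * b - 1) : ℕ) :
    ZMod ((p ^ α) ^ 2)) = Y at *
  linear_combination V * key - X * hV + Y * hU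
end

section
/- Let k ≥ 1 be an odd integer and let a be a positive integer. Then binom(2ka − 1, 2k − 1) ≡ (−1)^{a+1} · binom(ka − 1, k − 1) (mod 4). -/
theorem aux_choose_step (n k : ℕ) :
    (n.choose (k + 1) : ℤ) * (k + 1) = n.choose k * ((n : ℤ) - k) := by
  rcases le_or_gt k n with h | h
  · have := Nat.choose_succ_right_eq n k
    have h2 : ((n - k : ℕ) : ℤ) = (n : ℤ) - k := by push_cast [h]; ring
    rw [← h2]
    exact_mod_cast this
  · rw [Nat.choose_eq_zero_of_lt h, Nat.choose_eq_zero_of_lt (by omega)]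
    simp

theorem aux_prod (m k : ℕ) :
    ((2 * m + 1).choose (2 * k + 1) : ℤ) * ∏ i ∈ Finset.range (k + 1), (2 * (i : ℤ) + 1) =
      m.choose k * ∏ i ∈ Finset.range (k + 1), (2 * ((m : ℤ) + 1) - (2 * (i : ℤ) + 1)) := by
  induction k with
  | zero => simp; ring
  | succ k ih =>
    rw [Finset.prod_range_succ, Finset.prod_range_succ _ (k + 1)]
    generalize (∏ i ∈ Finset.range (k + 1), (2 * (i : ℤ) + 1)) = P at *
    generalize (∏ i ∈ Finset.range (k + 1), (2 * ((m : ℤ) + 1) - (2 * (i : ℤ) + 1))) = Q at *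
    have h1 := aux_choose_step (2 * m + 1) (2 * k + 1)
    have h2 := aux_choose_step (2 * m + 1) (2 * k + 1 + 1)
    have h3 := aux_choose_step m k
    have e : 2 * (k + 1) + 1 = 2 * k + 1 + 1 + 1 := by ring
    rw [e]
    push_cast at *
    have hk : (2 * (k : ℤ) + 2) ≠ 0 := by positivity
    apply mul_left_cancel₀ hk
    linear_combination (2 * (k : ℤ) + 2) * P * h2 + (2 * (m : ℤ) - 2 * k - 1) * P * h1
      + (2 * (m : ℤ) - 2 * k - 1) * 2 * ((m : ℤ) - k) * ih
      - 2 * Q * (2 * (m : ℤ) - 2 * k - 1) * h3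

theorem aux_factor (n : ℕ) (i : ℤ) :
    2 * (n : ℤ) - (2 * i + 1) ≡ (-1) ^ (n + 1) * (2 * i + 1) [ZMOD 4] := by
  rcases Nat.even_or_odd n with h | h
  · rw [h.add_one.neg_one_pow]
    obtain ⟨t, rfl⟩ := h
    exact (Int.modEq_iff_dvd.2 ⟨-t, by push_cast; ring⟩)
  · rw [h.add_one.neg_one_pow]
    obtain ⟨t, rfl⟩ := h
    exact (Int.modEq_iff_dvd.2 ⟨i - t, by push_cast; ring⟩)

theorem aux_prod_mod (n k : ℕ) :
    ∏ i ∈ Finset.range k, (2 * (n : ℤ) - (2 * (i : ℤ) + 1)) ≡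
      ((-1) ^ (n + 1)) ^ k * ∏ i ∈ Finset.range k, (2 * (i : ℤ) + 1) [ZMOD 4] := by
  induction k with
  | zero => simp
  | succ k ih =>
    rw [Finset.prod_range_succ, Finset.prod_range_succ _ k]
    refine (ih.mul (aux_factor n k)).trans ?_
    rw [pow_succ ((-1 : ℤ) ^ (n + 1)) k]
    refine Int.modEq_iff_dvd.2 ⟨0, ?_⟩
    ring

theorem aux_odd (k : ℕ) : IsCoprime (4 : ℤ) (∏ i ∈ Finset.range k, (2 * (i : ℤ) + 1)) := by
  apply IsCoprime.prod_right
  intro i _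
  have : IsCoprime (2 : ℤ) (2 * (i : ℤ) + 1) := ⟨-i, 1, by ring⟩
  have h := this.pow_left (m := 2)
  norm_num at h
  exact h

/-- For `k ≥ 1` odd and `a ≥ 1`,
`binom(2ka − 1, 2k − 1) ≡ (−1)^{a+1} binom(ka − 1, k − 1) (mod 4)`. -/
theorem binomial_congruence_mod_four (k a : ℕ) (hk : 1 ≤ k) (hkodd : Odd k)
    (ha : 1 ≤ a) :
    ((2 * k * a - 1).choose (2 * k - 1) : ℤ) ≡
      (-1) ^ (a + 1) * ((k * a - 1).choose (k - 1) : ℤ) [ZMOD 4] := by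
  have hpos : 1 ≤ k * a := Nat.mul_pos hk ha
  have key := aux_prod (k * a - 1) (k - 1)
  have e1 : 2 * (k * a - 1) + 1 = 2 * k * a - 1 := by
    rw [mul_assoc]; omega
  have e2 : 2 * (k - 1) + 1 = 2 * k - 1 := by omega
  have e3 : k - 1 + 1 = k := by omega
  have e4 : ((k * a - 1 : ℕ) : ℤ) + 1 = ((k * a : ℕ) : ℤ) := by
    exact_mod_cast Nat.sub_add_cancel hpos
  rw [e1, e2, e3, e4] at key
  have hmod := aux_prod_mod (k * a) k
  have hs : (((-1 : ℤ)) ^ (k * a + 1)) ^ k = (-1) ^ (a + 1) := by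
    rcases Nat.even_or_odd a with h | h
    · rw [(h.mul_left k).add_one.neg_one_pow, h.add_one.neg_one_pow, hkodd.neg_one_pow]
    · rw [(hkodd.mul h).add_one.neg_one_pow, h.add_one.neg_one_pow, one_pow]
  rw [hs] at hmod
  have h := hmod.mul_left ((k * a - 1).choose (k - 1) : ℤ)
  rw [← key] at h
  have hd := Int.modEq_iff_dvd.1 h
  apply Int.modEq_iff_dvd.2
  apply (aux_odd k).dvd_of_dvd_mul_right
  rw [sub_mul]
  refine hd.trans (dvd_of_eq ?_)
  ring
end

section
/- Let w, s, t be positive integers with t ∣ s and t ≠ s, let p be a prime and α ≥ 1 an integer with p^α ∥ (s/t); assume that either p ≠ 2 or α > 1. Then for every l ∈ I(s/(p^α·t)), the integer f(l) := ∑_{k ∈ {p^{α−1}·l, p^α·l}} (−1)^{ω(s/(kt))} (−1)^{ktw} binom(k(tw−1)−1, k−1) satisfies f(l) ≡ 0 (mod p^{2α}). -/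
/-- Generalized binomial coefficient `binom(n, j) = n(n−1)⋯(n−j+1)/j! ∈ ℤ`. -/
noncomputable def binom (n : ℤ) (j : ℕ) : ℤ := Ring.choose n j

/-- `I(n) = {k : k ∣ n and n/k is squarefree}` as a finset. -/
def Iset (n : ℕ) : Finset ℕ := n.divisors.filter fun k => Squarefree (n / k)

/-- `ω(n)`: the number of distinct prime factors of `n`. -/
def omega (n : ℕ) : ℕ := n.primeFactors.card

lemma choose_prod (x : ℤ) (k : ℕ) (hk : 1 ≤ k) :
    ((k - 1).factorial : ℤ) * binom (x - 1) (k - 1) = ∏ i ∈ Finset.Ico 1 k, (x - (i : ℤ)) := by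
  have h := Ring.descPochhammer_eq_factorial_smul_choose (x - 1) (k - 1)
  rw [nsmul_eq_mul] at h
  unfold binom
  rw [← h, Finset.prod_Ico_eq_prod_range]
  generalize k - 1 = n
  induction n with
  | zero => simp
  | succ n ih =>
    rw [Finset.prod_range_succ, ← ih, descPochhammer_succ_right, Polynomial.smeval_mul,
      Polynomial.smeval_sub, Polynomial.smeval_X, Polynomial.smeval_natCast]
    push_cast
    simp
    left
    ring

lemma fact_prod (k : ℕ) (hk : 1 ≤ k) :
    ((k - 1).factorial : ℤ) = ∏ i ∈ Finset.Ico 1 k, (i : ℤ) := by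
  obtain ⟨n, rfl⟩ : ∃ n, k = n + 1 := ⟨k - 1, by omega⟩
  rw [← Nat.cast_prod, Finset.prod_Ico_id_eq_factorial]
  simp

lemma split_prod (p k : ℕ) (hp : 0 < p) (f : ℕ → ℤ) :
    ∏ i ∈ Finset.Ico 1 (p * k), f i =
      (∏ i ∈ (Finset.Ico 1 (p * k)).filter (fun i => ¬ p ∣ i), f i) *
        ∏ j ∈ Finset.Ico 1 k, f (p * j) := by
  rw [← Finset.prod_filter_mul_prod_filter_not (Finset.Ico 1 (p * k)) (fun i => p ∣ i), mul_comm]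
  congr 1
  symm
  apply Finset.prod_bij (fun j _ => p * j)
  · intro j hj
    simp only [Finset.mem_Ico, Finset.mem_filter] at hj ⊢
    refine ⟨⟨?_, ?_⟩, dvd_mul_right _ _⟩
    · exact Nat.mul_pos hp hj.1
    · exact Nat.mul_lt_mul_of_pos_left hj.2 hp
  · intro a _ b _ h
    exact Nat.eq_of_mul_eq_mul_left hp h
  · intro i hi
    simp only [Finset.mem_Ico, Finset.mem_filter] at hi
    obtain ⟨⟨h1, h2⟩, j, rfl⟩ := hi
    refine ⟨j, ?_, rfl⟩
    simp only [Finset.mem_Ico]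
    exact ⟨Nat.pos_of_mul_pos_left h1, Nat.lt_of_mul_lt_mul_left h2⟩
  · intros; rfl

lemma pair_prod (p k : ℕ) (hpk : p ∣ k) (hhalf : ∀ i, k = 2 * i → p ∣ i) (f : ℕ → ℤ) :
    ∏ i ∈ (Finset.Ico 1 k).filter (fun i => ¬ p ∣ i), f i =
      ∏ i ∈ ((Finset.Ico 1 k).filter (fun i => ¬ p ∣ i)).filter (fun i => 2 * i < k),
        (f i * f (k - i)) := by
  rw [← Finset.prod_filter_mul_prod_filter_not ((Finset.Ico 1 k).filter (fun i => ¬ p ∣ i))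
    (fun i => 2 * i < k), Finset.prod_mul_distrib]
  congr 1
  symm
  apply Finset.prod_bij (fun j _ => k - j)
  · intro j hj
    simp only [Finset.mem_Ico, Finset.mem_filter] at hj ⊢
    refine ⟨⟨by omega, fun h => hj.1.2 ?_⟩, by omega⟩
    have := Nat.dvd_sub hpk h
    rwa [show k - (k - j) = j by omega] at this
  · intro a ha b hb h
    simp only [Finset.mem_Ico, Finset.mem_filter] at ha hb
    omega
  · intro i hi
    simp only [Finset.mem_Ico, Finset.mem_filter] at hi
    refine ⟨k - i, ?_, by omega⟩
    simp only [Finset.mem_Ico, Finset.mem_filter]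
    have hne : k ≠ 2 * i := fun h => hi.1.2 (hhalf i h)
    refine ⟨⟨by omega, fun h => hi.1.2 ?_⟩, by omega⟩
    have := Nat.dvd_sub hpk h
    rwa [show k - (k - i) = i by omega] at this
  · intros; rfl

lemma prod_cong (p k : ℕ) (hpk : p ∣ k) (hhalf : ∀ i, k = 2 * i → p ∣ i) (M : ℤ) :
    ∏ i ∈ (Finset.Ico 1 k).filter (fun i => ¬ p ∣ i), ((k : ℤ) * M - (i : ℤ)) ≡
      ∏ i ∈ (Finset.Ico 1 k).filter (fun i => ¬ p ∣ i), (i : ℤ) [ZMOD (k : ℤ) ^ 2] := by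
  rw [pair_prod p k hpk hhalf, pair_prod p k hpk hhalf]
  apply Int.ModEq.prod
  intro i hi
  simp only [Finset.mem_Ico, Finset.mem_filter] at hi
  rw [Nat.cast_sub (by omega)]
  apply Int.ModEq.symm
  rw [Int.modEq_iff_dvd]
  exact ⟨M ^ 2 - M, by ring⟩

lemma binom_cong (p k' e : ℕ) (hp : p.Prime) (hk' : 1 ≤ k')
    (hhalf : ∀ i, p * k' = 2 * i → p ∣ i) (M : ℤ) (he : p ^ e ∣ (p * k') ^ 2) :
    binom ((p * k' : ℕ) * M - 1) (p * k' - 1) ≡ binom ((k' : ℕ) * M - 1) (k' - 1)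
      [ZMOD (p : ℤ) ^ e] := by
  have hk : 1 ≤ p * k' := Nat.mul_pos hp.pos hk'
  have h1 := choose_prod (((p * k' : ℕ) : ℤ) * M) (p * k') hk
  have h2 := choose_prod ((k' : ℤ) * M) k' hk'
  have h3 := fact_prod (p * k') hk
  have h4 := fact_prod k' hk'
  have hc := prod_cong p (p * k') (dvd_mul_right _ _) hhalf M
  rw [split_prod p k' hp.pos] at h1 h3
  have h5 : ∏ j ∈ Finset.Ico 1 k', (((p * k' : ℕ) : ℤ) * M - ((p * j : ℕ) : ℤ)) =
      (p : ℤ) ^ (k' - 1) * ∏ j ∈ Finset.Ico 1 k', ((k' : ℤ) * M - (j : ℤ)) := by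
    rw [← Nat.card_Ico 1 k', ← Finset.prod_const, ← Finset.prod_mul_distrib]
    apply Finset.prod_congr rfl
    intros; push_cast; ring
  have h6 : ∏ j ∈ Finset.Ico 1 k', ((p * j : ℕ) : ℤ) =
      (p : ℤ) ^ (k' - 1) * ∏ j ∈ Finset.Ico 1 k', (j : ℤ) := by
    rw [← Nat.card_Ico 1 k', ← Finset.prod_const, ← Finset.prod_mul_distrib]
    apply Finset.prod_congr rfl
    intros; push_cast; ring
  rw [h5, ← h2] at h1
  rw [h6, ← h4] at h3
  rw [h3] at h1
  have hcop : IsCoprime ((p : ℤ) ^ e)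
      (∏ i ∈ (Finset.Ico 1 (p * k')).filter (fun i => ¬ p ∣ i), (i : ℤ)) := by
    apply IsCoprime.pow_left
    apply IsCoprime.prod_right
    intro i hi
    rw [Nat.isCoprime_iff_coprime]
    exact (hp.coprime_iff_not_dvd).2 (Finset.mem_filter.1 hi).2
  revert hc h1 hcop
  generalize ∏ i ∈ (Finset.Ico 1 (p * k')).filter (fun i => ¬ p ∣ i), (i : ℤ) = Q
  generalize ∏ i ∈ (Finset.Ico 1 (p * k')).filter (fun i => ¬ p ∣ i),
    (((p * k' : ℕ) : ℤ) * M - (i : ℤ)) = P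
  generalize binom ((p * k' : ℕ) * M - 1) (p * k' - 1) = A
  generalize binom ((k' : ℕ) * M - 1) (k' - 1) = B
  intro h1 hc hcop
  have hne : (p : ℤ) ^ (k' - 1) * ((k' - 1).factorial : ℤ) ≠ 0 := by
    have := hp.ne_zero
    have := Nat.factorial_ne_zero (k' - 1)
    positivity
  have hAB : Q * A = P * B := by
    apply mul_left_cancel₀ hne
    linear_combination h1
  have he' : (p : ℤ) ^ e ∣ ((p * k' : ℕ) : ℤ) ^ 2 := by exact_mod_cast he
  have hPQ : (p : ℤ) ^ e ∣ Q - P := he'.trans hc.dvd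
  apply Int.ModEq.symm
  rw [Int.modEq_iff_dvd]
  apply hcop.dvd_of_dvd_mul_left
  rw [mul_sub, hAB, show P * B - Q * B = -((Q - P) * B) by ring]
  exact (hPQ.mul_right B).neg_right

/-- Let `t ∣ s`, `t ≠ s`, `p^α ∥ s/t` with `p` prime, `α ≥ 1`,
and assume `p ≠ 2` or `α > 1`. Then for every `l ∈ I(s/(p^α t))`, the integer
`f(l) = ∑_{k ∈ {p^{α−1}l, p^α l}} (−1)^{ω(s/(kt))} (−1)^{ktw} binom(k(tw−1)−1, k−1)`
is `≡ 0 (mod p^{2α})`. -/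
theorem f_vanishes_mod_p_two_alpha (w s t : ℕ) (hw : 1 ≤ w) (hs : 1 ≤ s)
    (ht : 1 ≤ t) (hts : t ∣ s) (hne : t ≠ s)
    (p : ℕ) (hp : p.Prime) (α : ℕ) (hα : 1 ≤ α)
    (hdvd : p ^ α ∣ s / t) (hndvd : ¬ p ^ (α + 1) ∣ s / t)
    (hcase : p ≠ 2 ∨ 1 < α) :
    ∀ l ∈ Iset (s / (p ^ α * t)),
      ((-1 : ℤ) ^ omega (s / (p ^ (α - 1) * l * t)) *
            (-1 : ℤ) ^ (p ^ (α - 1) * l * t * w) *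
            binom ((p ^ (α - 1) * l : ℕ) * ((t : ℤ) * (w : ℤ) - 1) - 1)
              (p ^ (α - 1) * l - 1) +
          (-1 : ℤ) ^ omega (s / (p ^ α * l * t)) *
            (-1 : ℤ) ^ (p ^ α * l * t * w) *
            binom ((p ^ α * l : ℕ) * ((t : ℤ) * (w : ℤ) - 1) - 1)
              (p ^ α * l - 1)) ≡ 0 [ZMOD (p : ℤ) ^ (2 * α)] := by
  intro l hl
  unfold Iset at hl
  rw [Finset.mem_filter, Nat.mem_divisors] at hl
  obtain ⟨⟨hlm, hm0⟩, -⟩ := hl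
  obtain ⟨n, rfl⟩ := hts
  rw [Nat.mul_div_cancel_left _ ht] at hdvd hndvd
  obtain ⟨m, rfl⟩ := hdvd
  have hpm : ¬ p ∣ m := by
    rintro ⟨c, rfl⟩
    exact hndvd ⟨c, by ring⟩
  have hpa : 0 < p ^ α := pow_pos hp.pos _
  rw [show t * (p ^ α * m) = p ^ α * t * m by ring,
    Nat.mul_div_cancel_left _ (Nat.mul_pos hpa ht)] at hlm hm0
  obtain ⟨c, rfl⟩ := hlm
  obtain ⟨a, rfl⟩ : ∃ a, α = a + 1 := ⟨α - 1, by omega⟩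
  have hl0 : 0 < l := Nat.pos_of_ne_zero (left_ne_zero_of_mul hm0)
  have hc0 : c ≠ 0 := right_ne_zero_of_mul hm0
  have hpc : ¬ p ∣ c := fun h => hpm (h.mul_left l)
  have hpa' : 0 < p ^ a := pow_pos hp.pos _
  rw [Nat.add_sub_cancel]
  have e1 : t * (p ^ (a + 1) * (l * c)) / (p ^ a * l * t) = p * c := by
    rw [show t * (p ^ (a + 1) * (l * c)) = (p ^ a * l * t) * (p * c) by ring]
    exact Nat.mul_div_cancel_left _ (by positivity)
  have e2 : t * (p ^ (a + 1) * (l * c)) / (p ^ (a + 1) * l * t) = c := by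
    rw [show t * (p ^ (a + 1) * (l * c)) = (p ^ (a + 1) * l * t) * c by ring]
    exact Nat.mul_div_cancel_left _ (by positivity)
  have e3 : omega (p * c) = omega c + 1 := by
    unfold omega
    rw [Nat.primeFactors_mul hp.ne_zero hc0, hp.primeFactors, Finset.card_union_of_disjoint,
      Finset.card_singleton, add_comm]
    rw [Finset.disjoint_singleton_left]
    exact fun h => hpc (Nat.dvd_of_mem_primeFactors h)
  have e4 : (-1 : ℤ) ^ (p ^ (a + 1) * l * t * w) = (-1 : ℤ) ^ (p ^ a * l * t * w) := by
    rw [show p ^ (a + 1) * l * t * w = p * (p ^ a * l * t * w) by ring, pow_mul]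
    rcases hp.eq_two_or_odd' with h2 | hodd
    · have ha : a ≠ 0 := by
        rcases hcase with h | h
        · exact absurd h2 h
        · omega
      have hev : Even (p ^ a * l * t * w) := by
        have : Even (p ^ a) := by
          rw [h2]; exact (even_two).pow_of_ne_zero ha
        exact ((this.mul_right _).mul_right _).mul_right _
      rw [hev.neg_one_pow, ← pow_mul, (hev.mul_left p).neg_one_pow]
    · rw [hodd.neg_one_pow]
  have hk : p ^ (a + 1) * l = p * (p ^ a * l) := by ring
  have key := binom_cong p (p ^ a * l) (2 * (a + 1)) hp (Nat.mul_pos hpa' hl0) ?_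
    ((t : ℤ) * (w : ℤ) - 1) ⟨l ^ 2, by ring⟩
  · rw [← hk] at key
    rw [e1, e2, e3, e4]
    revert key
    generalize binom ((p ^ (a + 1) * l : ℕ) * ((t : ℤ) * (w : ℤ) - 1) - 1)
      (p ^ (a + 1) * l - 1) = A
    generalize binom ((p ^ a * l : ℕ) * ((t : ℤ) * (w : ℤ) - 1) - 1) (p ^ a * l - 1) = B
    intro key
    apply Int.ModEq.symm
    rw [Int.modEq_iff_dvd]
    have := key.symm.dvd
    have h := this.mul_left ((-1 : ℤ) ^ omega c * (-1 : ℤ) ^ (p ^ a * l * t * w))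
    refine h.trans (dvd_of_eq ?_)
    rw [pow_succ]
    ring
  · intro i hi
    rcases eq_or_ne p 2 with h2 | h2
    · have ha : a ≠ 0 := by
        rcases hcase with h | h
        · exact absurd h2 h
        · omega
      subst h2
      have : i = 2 ^ a * l := by omega
      rw [this]
      exact (dvd_pow_self 2 ha).mul_right l
    · have h : p ∣ 2 * i := ⟨_, hi.symm⟩
      rcases hp.dvd_mul.1 h with h | h
      · exact absurd ((Nat.prime_dvd_prime_iff_eq hp Nat.prime_two).1 h) h2
      · exact h
end
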